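/- Let F ⊆ ℝⁿ be closed and nonempty and take the cylindrical target set M = [0,ϑ] × F. Define W₀ = W₀* = [0,ϑ] × ℝⁿ, W_k = A(W_{k−1}) and W_k* = A*(W*_{k−1}) for k ∈ ℕ, where A is the program absorption operator for ẋ = f(x,u,v) with target M, and A* is the program absorption operator for the switched system ẋ = ν·f(x,u,v), with first-player control (ν,u) ∈ {0,1} × P, with target M* = {ϑ} × F. Then W_k = W_k* for every k ≥ 0. -/

import Mathlib

open MeasureTheory

noncomputable section

/-- A slide control on `[0,ϑ] × Λ`: a Borel measure on `ℝ × C` carried by `[0,ϑ] × Λ`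
whose marginal on the time axis is Lebesgue measure on `[0,ϑ]`. -/
def IsSlideControl {C : Type*} [MeasurableSpace C] (ϑ : ℝ) (Λ : Set C)
    (μ : Measure (ℝ × C)) : Prop :=
  μ.map Prod.fst = volume.restrict (Set.Icc 0 ϑ) ∧ μ ((Set.Icc 0 ϑ ×ˢ Λ)ᶜ) = 0

/-- A motion of `ẋ = h(x,b)` generated by the slide control `μ` from the position
`(t₀, x₀)`. -/
def IsMotion {C : Type*} {n : ℕ} [MeasurableSpace C] (ϑ : ℝ) (Λ : Set C)
    (h : EuclideanSpace ℝ (Fin n) → C → EuclideanSpace ℝ (Fin n))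
    (μ : Measure (ℝ × C)) (t₀ : ℝ) (x₀ : EuclideanSpace ℝ (Fin n))
    (x : ℝ → EuclideanSpace ℝ (Fin n)) : Prop :=
  ContinuousOn x (Set.Icc 0 ϑ) ∧ x t₀ = x₀ ∧
  (∀ t ∈ Set.Icc 0 ϑ, t₀ ≤ t →
    x t = x₀ + ∫ z in Set.Icc t₀ t ×ˢ Λ, h (x z.1) z.2 ∂μ) ∧
  (∀ t ∈ Set.Icc 0 ϑ, t ≤ t₀ →
    x t = x₀ - ∫ z in Set.Icc t t₀ ×ˢ Λ, h (x z.1) z.2 ∂μ)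

/-- The program absorption operator `A` of the game `ẋ = f(x,u,v)` with the cylindrical
target set `M = [0,ϑ] × F`. -/
def progAbsorbCyl {n p q : ℕ} (ϑ : ℝ)
    (P : Set (EuclideanSpace ℝ (Fin p))) (Q : Set (EuclideanSpace ℝ (Fin q)))
    (f : EuclideanSpace ℝ (Fin n) → EuclideanSpace ℝ (Fin p) → EuclideanSpace ℝ (Fin q) →
      EuclideanSpace ℝ (Fin n))
    (F : Set (EuclideanSpace ℝ (Fin n))) (E : Set (ℝ × EuclideanSpace ℝ (Fin n))) :
    Set (ℝ × EuclideanSpace ℝ (Fin n)) :=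
  {pt ∈ E | ∀ v ∈ Q, ∃ μ : Measure (ℝ × EuclideanSpace ℝ (Fin p)),
    IsSlideControl ϑ P μ ∧ ∃ ξ ∈ Set.Icc pt.1 ϑ, ∃ y : ℝ → EuclideanSpace ℝ (Fin n),
      IsMotion ϑ P (fun x u => f x u v) μ pt.1 pt.2 y ∧ y ξ ∈ F ∧
      ∀ t ∈ Set.Icc pt.1 ξ, (t, y t) ∈ E}

/-- The program absorption operator `A*` of the switched game `ẋ = ν·f(x,u,v)`,
`(ν,u) ∈ P* = {0,1} × P`, with target set `M* = {ϑ} × F`. -/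
def progAbsorbSwitched {n p q : ℕ} (ϑ : ℝ)
    (P : Set (EuclideanSpace ℝ (Fin p))) (Q : Set (EuclideanSpace ℝ (Fin q)))
    (f : EuclideanSpace ℝ (Fin n) → EuclideanSpace ℝ (Fin p) → EuclideanSpace ℝ (Fin q) →
      EuclideanSpace ℝ (Fin n))
    (F : Set (EuclideanSpace ℝ (Fin n))) (E : Set (ℝ × EuclideanSpace ℝ (Fin n))) :
    Set (ℝ × EuclideanSpace ℝ (Fin n)) :=
  {pt ∈ E | ∀ v ∈ Q, ∃ μ : Measure (ℝ × (ℝ × EuclideanSpace ℝ (Fin p))),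
    IsSlideControl ϑ (({0, 1} : Set ℝ) ×ˢ P) μ ∧ ∃ y : ℝ → EuclideanSpace ℝ (Fin n),
      IsMotion ϑ (({0, 1} : Set ℝ) ×ˢ P) (fun x w => w.1 • f x w.2 v) μ pt.1 pt.2 y ∧
      y ϑ ∈ F ∧ ∀ t ∈ Set.Icc pt.1 ϑ, (t, y t) ∈ E}

theorem aux_ode_fwd {n : ℕ} (g : EuclideanSpace ℝ (Fin n) → EuclideanSpace ℝ (Fin n))
    (hg : LocallyLipschitz g) (c : ℝ) (hc : 0 < c) (hgr : ∀ x, ‖g x‖ ≤ c * (1 + ‖x‖))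
    (x₀ : EuclideanSpace ℝ (Fin n)) (T : ℝ) (hT : 0 ≤ T) :
    ∃ w : ℝ → EuclideanSpace ℝ (Fin n), Continuous w ∧ w 0 = x₀ ∧
      ∀ t ∈ Set.Icc 0 T, w t = x₀ + ∫ s in (0 : ℝ)..t, g (w s) := by
  classical
  set R : ℝ := max 1 (gronwallBound ‖x₀‖ c c T) with hR
  have hR1 : 1 ≤ R := le_max_left _ _
  let φ : ContDiffBump (0 : EuclideanSpace ℝ (Fin n)) := ⟨R, R + 1, by linarith, by linarith⟩
  let h : EuclideanSpace ℝ (Fin n) → EuclideanSpace ℝ (Fin n) := fun x => φ x • x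
  have hh : ContDiff ℝ 1 h := φ.contDiff.smul contDiff_id
  have hhl : LocallyLipschitz h := hh.locallyLipschitz
  have hle : ∀ x, ‖h x‖ ≤ ‖x‖ := fun x => by
    simp only [h, norm_smul, Real.norm_eq_abs, abs_of_nonneg (φ.nonneg' x)]
    exact mul_le_of_le_one_left (norm_nonneg _) φ.le_one
  have hbd : ∀ x, ‖h x‖ ≤ R + 1 := fun x => by
    by_cases hx : ‖x‖ ≤ R + 1
    · exact (hle x).trans hx
    · have : φ x = 0 := φ.zero_of_le_dist (by simpa [φ] using (not_le.1 hx).le)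
      simp only [h, this, zero_smul, norm_zero]; linarith
  have hid : ∀ x, ‖x‖ ≤ R → h x = x := fun x hx => by
    have : φ x = 1 := φ.one_of_mem_closedBall (by simpa [φ] using hx)
    simp [h, this]
  have hGl : LocallyLipschitz (g ∘ h) := hg.comp hhl
  set M : ℝ := c * (1 + (R + 1)) with hM
  have hM0 : 0 ≤ M := by positivity
  have hGM : ∀ x, ‖g (h x)‖ ≤ M := fun x => (hgr _).trans (by have := hbd x; rw [hM]; gcongr)
  obtain ⟨K, hK⟩ := (hGl.locallyLipschitzOn (s := Metric.closedBall x₀ (M * T))).exists_lipschitzOnWith_of_compact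
    (isCompact_closedBall _ _)
  have hPL : IsPicardLindelof (fun _ => g ∘ h) (tmin := 0) (tmax := T) ⟨0, le_rfl, hT⟩ x₀
      (Real.toNNReal (M * T)) 0 (Real.toNNReal M) K := by
    constructor
    · intro t _
      rwa [Real.coe_toNNReal _ (by positivity)]
    · intro x _; exact continuousOn_const
    · intro t _ x _
      rw [Real.coe_toNNReal _ hM0]; exact hGM x
    · simp [Real.coe_toNNReal _ hM0, Real.coe_toNNReal _ (mul_nonneg hM0 hT), hT]
  obtain ⟨α, hα0, hα⟩ := hPL.exists_eq_forall_mem_Icc_hasDerivWithinAt₀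
  have hαc : ContinuousOn α (Set.Icc 0 T) := fun t ht => (hα t ht).continuousWithinAt
  have hαb : ∀ t ∈ Set.Icc 0 T, ‖α t‖ ≤ R := by
    intro t ht
    have := norm_le_gronwallBound_of_norm_deriv_right_le (f := α) (f' := fun t => g (h (α t)))
      (K := c) (ε := c) (δ := ‖x₀‖) hαc
      (fun x hx => (hα x ⟨hx.1, hx.2.le⟩).mono_of_mem_nhdsWithin (Icc_mem_nhdsGE_of_mem hx))
      (by rw [← hα0]) (fun x hx => by
        refine (hgr _).trans ?_
        have := hle (α x)
        nlinarith) t ht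
    refine this.trans ((gronwallBound_mono (norm_nonneg _) hc.le hc.le ?_).trans (le_max_right _ _))
    simpa using ht.2
  let w : ℝ → EuclideanSpace ℝ (Fin n) := Set.IccExtend hT ((Set.Icc 0 T).domRestrict α)
  have hw : ∀ t ∈ Set.Icc 0 T, w t = α t := fun t ht => by
    simp only [w]
    rw [Set.IccExtend_of_mem _ _ ht]; rfl
  have hwc : Continuous w := (continuousOn_iff_continuous_domRestrict.1 hαc).Icc_extend'
  refine ⟨w, hwc, by rw [hw 0 ⟨le_rfl, hT⟩]; exact hα0, fun t ht => ?_⟩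
  have hwα : ∀ s ∈ Set.Icc 0 t, g (w s) = g (h (α s)) := fun s hs => by
    have hs' : s ∈ Set.Icc 0 T := ⟨hs.1, hs.2.trans ht.2⟩
    rw [hw s hs', hid _ (hαb s hs')]
  have e1 : ∫ s in (0 : ℝ)..t, g (w s) = α t - α 0 := by
    refine intervalIntegral.integral_eq_sub_of_hasDeriv_right_of_le ht.1
      (hαc.mono (Set.Icc_subset_Icc_right ht.2)) (fun s hs => ?_)
      ((hg.continuous.comp hwc).intervalIntegrable _ _)
    rw [hwα s ⟨hs.1.le, hs.2.le⟩]
    exact (hα s ⟨hs.1.le, hs.2.le.trans ht.2⟩).mono_of_mem_nhdsWithin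
      (Filter.mem_of_superset (Ioc_mem_nhdsGT (hs.2.trans_le ht.2)) (fun r hr => ⟨hs.1.le.trans hr.1.le, hr.2⟩))
  rw [e1, hw t ht, hα0]; simp

theorem aux_integrable {U X : Type*} [TopologicalSpace U] [MeasurableSpace U] [BorelSpace U]
    [SecondCountableTopology U] [NormedAddCommGroup X] [SecondCountableTopology X]
    (P : Set U) (hP : IsCompact P) (a b : ℝ) (ρ : Measure (ℝ × U)) [IsFiniteMeasure ρ]
    (hae : ∀ᵐ w ∂ρ, w.1 ∈ Set.Icc a b ∧ w.2 ∈ P) (φ : ℝ × U → X) (hφ : Continuous φ) :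
    Integrable φ ρ := by
  obtain ⟨K, hK⟩ := (isCompact_Icc (a := a) (b := b)).prod hP |>.exists_bound_of_continuousOn
    hφ.continuousOn
  borelize X
  refine Integrable.of_bound hφ.aestronglyMeasurable K ?_
  filter_upwards [hae] with w hw using hK w hw

theorem aux_ae {C : Type*} [MeasurableSpace C] (Λ : Set C) (T : Set ℝ) (hT : MeasurableSet T)
    (ρ : Measure (ℝ × C))
    (h1 : ρ.map Prod.fst ≤ volume.restrict T)
    (h2 : ρ ((Set.univ ×ˢ Λ)ᶜ) = 0) : ∀ᵐ w ∂ρ, w.1 ∈ T ∧ w.2 ∈ Λ := by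
  have a : ∀ᵐ t ∂(ρ.map Prod.fst), t ∈ T := by
    have := ae_restrict_mem (μ := volume) hT
    exact (Measure.absolutelyContinuous_of_le h1).ae_le this
  have a' := ae_of_ae_map measurable_fst.aemeasurable a
  have b : ∀ᵐ w ∂ρ, w ∈ (Set.univ ×ˢ Λ : Set (ℝ × C)) := h2
  filter_upwards [a', b] with w h1 h2 using ⟨h1, h2.2⟩

theorem aux_finite {C : Type*} [MeasurableSpace C] (a b : ℝ)
    (ρ : Measure (ℝ × C)) (h1 : ρ.map Prod.fst ≤ volume.restrict (Set.Icc a b)) :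
    IsFiniteMeasure ρ := by
  constructor
  have := h1 Set.univ
  rw [Measure.map_apply measurable_fst MeasurableSet.univ] at this
  refine lt_of_le_of_lt this ?_
  simp

theorem aux_ext {C : Type*} {n : ℕ} [MeasurableSpace C] [MeasurableSingletonClass C] (ϑ : ℝ)
    (Λ : Set C) (hΛ : MeasurableSet Λ)
    (h : EuclideanSpace ℝ (Fin n) → C → EuclideanSpace ℝ (Fin n)) (c₀ : C) (hc₀ : c₀ ∈ Λ)
    (hc : Continuous fun x => h x c₀) (t₀ ξ : ℝ) (ht₀ : 0 ≤ t₀) (ht : t₀ ≤ ξ) (hξ : ξ ≤ ϑ)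
    (ρ : Measure (ℝ × C)) (h1 : ρ.map Prod.fst = volume.restrict (Set.Icc t₀ ξ))
    (h2 : ρ ((Set.univ ×ˢ Λ)ᶜ) = 0) (x₀ : EuclideanSpace ℝ (Fin n))
    (z w₁ w₂ : ℝ → EuclideanSpace ℝ (Fin n)) (hz : Continuous z) (hw₁ : Continuous w₁)
    (hw₂ : Continuous w₂) (hz0 : z t₀ = x₀) (hw₁0 : w₁ t₀ = x₀) (hw₂0 : w₂ ξ = z ξ)
    (hzi : ∀ s ∈ Set.Icc t₀ ξ, z s = x₀ + ∫ w in Prod.fst ⁻¹' Set.Iic s, h (z w.1) w.2 ∂ρ)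
    (hint : Integrable (fun w : ℝ × C => h (z w.1) w.2) ρ)
    (hw₁i : ∀ s ∈ Set.Icc 0 t₀, w₁ s = x₀ - ∫ r in s..t₀, h (w₁ r) c₀)
    (hw₂i : ∀ s ∈ Set.Icc ξ ϑ, w₂ s = z ξ + ∫ r in ξ..s, h (w₂ r) c₀) :
    ∃ (μ : Measure (ℝ × C)) (y : ℝ → EuclideanSpace ℝ (Fin n)), IsSlideControl ϑ Λ μ ∧
      IsMotion ϑ Λ h μ t₀ x₀ y ∧ (∀ s ∈ Set.Icc t₀ ξ, y s = z s) ∧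
      ∀ s ∈ Set.Icc ξ ϑ, y s = w₂ s := by
  have hae := aux_ae Λ _ measurableSet_Icc ρ h1.le h2
  let S : Set ℝ := Set.Ico 0 t₀ ∪ Set.Ioc ξ ϑ
  have hS : MeasurableSet S := measurableSet_Ico.union measurableSet_Ioc
  let i : ℝ → ℝ × C := fun s => (s, c₀)
  have hi : MeasurableEmbedding i := measurableEmbedding_prod_mk_right c₀
  let y : ℝ → EuclideanSpace ℝ (Fin n) := fun s =>
    if s ≤ t₀ then w₁ s else if s ≤ ξ then z s else w₂ s
  have hyc : Continuous y := by
    refine Continuous.if_le hw₁ (Continuous.if_le hz hw₂ continuous_id continuous_const ?_)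
      continuous_id continuous_const ?_
    · rintro s rfl; exact hw₂0.symm
    · rintro s rfl; simp [ht, hz0, hw₁0]
  have hy1 : ∀ s, s ≤ t₀ → y s = w₁ s := fun s hs => by simp [y, hs]
  have hyz : ∀ s ∈ Set.Icc t₀ ξ, y s = z s := fun s hs => by
    rcases hs.1.eq_or_lt with rfl | h'
    · rw [hy1 _ le_rfl, hw₁0, hz0]
    · simp [y, not_le.2 h', hs.2]
  have hy2 : ∀ s, ξ ≤ s → y s = w₂ s := fun s hs => by
    rcases hs.eq_or_lt with rfl | h'
    · rw [hyz _ ⟨ht, le_rfl⟩, hw₂0]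
    · simp [y, not_le.2 h', not_le.2 (ht.trans_lt h')]
  let μ : Measure (ℝ × C) := ρ + (volume.restrict S).map i
  have hcy : Continuous fun s => h (y s) c₀ := hc.comp hyc
  have hSint : IntegrableOn (fun s => h (y s) c₀) S := by
    refine (hcy.integrableOn_Icc (a := 0) (b := ϑ)).mono_set ?_
    rintro s (hs | hs)
    · exact ⟨hs.1, by linarith [hs.2]⟩
    · exact ⟨by linarith [hs.1], hs.2⟩
  have hψρ : (fun w : ℝ × C => h (y w.1) w.2) =ᵐ[ρ] fun w => h (z w.1) w.2 := by
    filter_upwards [hae] with w hw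
    rw [hyz _ hw.1]
  have G : ∀ J : Set ℝ, MeasurableSet J → ∫ w in J ×ˢ Λ, h (y w.1) w.2 ∂μ =
      ∫ w in Prod.fst ⁻¹' J, h (z w.1) w.2 ∂ρ + ∫ s in J ∩ S, h (y s) c₀ := by
    intro J hJ
    have I1 : Integrable (fun w : ℝ × C => h (y w.1) w.2) ρ := hint.congr hψρ.symm
    have I2 : Integrable (fun w : ℝ × C => h (y w.1) w.2) ((volume.restrict S).map i) := by
      rw [hi.integrable_map_iff]; exact hSint
    simp only [μ]
    rw [Measure.restrict_add, integral_add_measure I1.restrict I2.restrict, hi.setIntegral_map,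
      Measure.restrict_restrict (hi.measurable (hJ.prod hΛ))]
    congr 1
    · rw [integral_congr_ae (ae_restrict_of_ae hψρ)]
      refine setIntegral_congr_set ?_
      filter_upwards [hae] with w hw
      apply propext
      exact ⟨fun h => h.1, fun h => ⟨h, hw.2⟩⟩
    · have : i ⁻¹' (J ×ˢ Λ) = J := by ext s; simp [i, hc₀]
      rw [this]
  refine ⟨μ, y, ⟨?_, ?_⟩, ⟨hyc.continuousOn, ?_, ?_, ?_⟩, hyz, fun s hs => hy2 s hs.1⟩
  · simp only [μ]
    rw [Measure.map_add _ _ measurable_fst, h1, Measure.map_map measurable_fst hi.measurable]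
    have : (Prod.fst ∘ i) = id := rfl
    rw [this, Measure.map_id, ← Measure.restrict_union _ hS]
    · congr 1
      ext s; simp only [S, Set.mem_union, Set.mem_Icc, Set.mem_Ico, Set.mem_Ioc]
      grind
    · rw [Set.disjoint_left]
      rintro s hs (h | h)
      · exact absurd h.2 (not_lt.2 hs.1)
      · exact absurd h.1 (not_lt.2 hs.2)
  · simp only [μ]
    rw [Measure.add_apply, hi.map_apply, add_eq_zero]
    constructor
    · change ∀ᵐ w ∂ρ, w ∈ Set.Icc 0 ϑ ×ˢ Λ
      filter_upwards [hae] with w hw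
      exact ⟨⟨ht₀.trans hw.1.1, hw.1.2.trans hξ⟩, hw.2⟩
    · rw [Measure.restrict_apply (hi.measurable ((measurableSet_Icc.prod hΛ).compl))]
      convert measure_empty (μ := (volume : Measure ℝ))
      rw [Set.eq_empty_iff_forall_notMem]
      rintro s ⟨hs, hs'⟩
      apply hs
      refine ⟨?_, hc₀⟩
      rcases hs' with hs | hs
      · exact ⟨hs.1, by linarith [hs.2]⟩
      · exact ⟨by linarith [hs.1], hs.2⟩
  · rw [hyz _ ⟨le_rfl, ht⟩, hz0]
  · intro t ht' ht0
    rw [G _ measurableSet_Icc]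
    rcases le_total t ξ with h' | h'
    · have e1 : Set.Icc t₀ t ∩ S = ∅ := by
        ext s; simp only [S, Set.mem_inter_iff, Set.mem_union, Set.mem_Icc, Set.mem_Ico, Set.mem_Ioc]
        grind
      rw [e1, Measure.restrict_empty, integral_zero_measure, add_zero, hyz _ ⟨ht0, h'⟩,
        hzi _ ⟨ht0, h'⟩]
      congr 1
      refine setIntegral_congr_set ?_
      filter_upwards [hae] with w hw
      apply propext
      exact ⟨fun h => ⟨hw.1.1, h⟩, fun h => h.2⟩
    · have e1 : Set.Icc t₀ t ∩ S = Set.Ioc ξ t := by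
        ext s; simp only [S, Set.mem_inter_iff, Set.mem_union, Set.mem_Icc, Set.mem_Ico, Set.mem_Ioc]
        have := ht'.2
        grind
      have e2 : ∫ w in Prod.fst ⁻¹' Set.Icc t₀ t, h (z w.1) w.2 ∂ρ =
          ∫ w in Prod.fst ⁻¹' Set.Iic ξ, h (z w.1) w.2 ∂ρ := by
        refine setIntegral_congr_set ?_
        filter_upwards [hae] with w hw
        apply propext
        exact ⟨fun h => hw.1.2, fun h => ⟨hw.1.1, hw.1.2.trans h'⟩⟩
      rw [e1, e2, ← add_assoc, ← hzi ξ ⟨ht, le_rfl⟩, hy2 t h', hw₂i t ⟨h', ht'.2⟩,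
        intervalIntegral.integral_of_le h']
      congr 1
      refine setIntegral_congr_fun measurableSet_Ioc fun s hs => ?_
      simp only [hy2 s hs.1.le]
  · intro t ht' ht0
    rw [G _ measurableSet_Icc]
    have e1 : Set.Icc t t₀ ∩ S = Set.Ico t t₀ := by
      ext s; simp only [S, Set.mem_inter_iff, Set.mem_union, Set.mem_Icc, Set.mem_Ico, Set.mem_Ioc]
      have := ht'.1
      grind
    have e2 : ∫ w in Prod.fst ⁻¹' Set.Icc t t₀, h (z w.1) w.2 ∂ρ = 0 := by
      refine setIntegral_measure_zero _ ?_
      rw [← Measure.map_apply measurable_fst measurableSet_Icc, h1,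
        Measure.restrict_apply measurableSet_Icc]
      refine measure_mono_null (t := {t₀}) ?_ (by simp)
      rintro s ⟨hs, hs'⟩
      exact le_antisymm hs.2 hs'.1
    rw [e1, e2, zero_add, hy1 t ht0, hw₁i t ⟨ht'.1, ht0⟩, intervalIntegral.integral_of_le ht0,
      integral_Ico_eq_integral_Ioc]
    congr 1
    refine setIntegral_congr_fun measurableSet_Ioc fun s hs => ?_
    simp only [hy1 s hs.2]

/-- Forward reachability of `F` inside `E` by a relaxed control defined only on `[t₀, ξ]`. -/
def AuxReach {n p : ℕ} (ϑ : ℝ) (P : Set (EuclideanSpace ℝ (Fin p)))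
    (g : EuclideanSpace ℝ (Fin n) → EuclideanSpace ℝ (Fin p) → EuclideanSpace ℝ (Fin n))
    (F : Set (EuclideanSpace ℝ (Fin n))) (E : Set (ℝ × EuclideanSpace ℝ (Fin n)))
    (t₀ : ℝ) (x₀ : EuclideanSpace ℝ (Fin n)) : Prop :=
  ∃ ξ ∈ Set.Icc t₀ ϑ, ∃ (ρ : Measure (ℝ × EuclideanSpace ℝ (Fin p)))
    (z : ℝ → EuclideanSpace ℝ (Fin n)),
    ρ.map Prod.fst = volume.restrict (Set.Icc t₀ ξ) ∧ ρ ((Set.univ ×ˢ P)ᶜ) = 0 ∧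
    Continuous z ∧ z t₀ = x₀ ∧
    (∀ s ∈ Set.Icc t₀ ξ, z s = x₀ + ∫ w in Prod.fst ⁻¹' Set.Iic s, g (z w.1) w.2 ∂ρ) ∧
    z ξ ∈ F ∧ ∀ s ∈ Set.Icc t₀ ξ, (s, z s) ∈ E

/-- The properties of the iterates which are preserved by the absorption operators. -/
structure AuxGood {n : ℕ} (ϑ : ℝ) (F : Set (EuclideanSpace ℝ (Fin n)))
    (E : Set (ℝ × EuclideanSpace ℝ (Fin n))) : Prop where
  sub : ∀ pt ∈ E, pt.1 ∈ Set.Icc 0 ϑ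
  tgt : ∀ t ∈ Set.Icc 0 ϑ, ∀ x ∈ F, (t, x) ∈ E
  down : ∀ t x s, (t, x) ∈ E → 0 ≤ s → s ≤ t → (s, x) ∈ E

theorem aux_reach_tgt {n p : ℕ} (ϑ : ℝ) (P : Set (EuclideanSpace ℝ (Fin p)))
    (g : EuclideanSpace ℝ (Fin n) → EuclideanSpace ℝ (Fin p) → EuclideanSpace ℝ (Fin n))
    (F : Set (EuclideanSpace ℝ (Fin n))) (E : Set (ℝ × EuclideanSpace ℝ (Fin n)))
    (hE : AuxGood ϑ F E) (t₀ : ℝ) (ht : t₀ ∈ Set.Icc 0 ϑ) (x₀ : EuclideanSpace ℝ (Fin n))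
    (hx : x₀ ∈ F) : AuxReach ϑ P g F E t₀ x₀ := by
  refine ⟨t₀, ⟨le_rfl, ht.2⟩, 0, fun _ => x₀, ?_, by simp, continuous_const, rfl, by simp, hx, ?_⟩
  · rw [Measure.map_zero, eq_comm, Measure.restrict_eq_zero]
    simp
  · intro s hs
    obtain rfl : s = t₀ := le_antisymm hs.2 hs.1
    exact hE.tgt _ ht _ hx

theorem aux_reach_down {n p : ℕ} (ϑ : ℝ) (P : Set (EuclideanSpace ℝ (Fin p)))
    (g : EuclideanSpace ℝ (Fin n) → EuclideanSpace ℝ (Fin p) → EuclideanSpace ℝ (Fin n))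
    (hg : Continuous fun w : EuclideanSpace ℝ (Fin n) × EuclideanSpace ℝ (Fin p) => g w.1 w.2)
    (hP : MeasurableSet P)
    (F : Set (EuclideanSpace ℝ (Fin n))) (E : Set (ℝ × EuclideanSpace ℝ (Fin n)))
    (hE : AuxGood ϑ F E) (t₀ s₀ : ℝ) (x₀ : EuclideanSpace ℝ (Fin n)) (hs0 : 0 ≤ s₀) (hst : s₀ ≤ t₀)
    (h : AuxReach ϑ P g F E t₀ x₀) : AuxReach ϑ P g F E s₀ x₀ := by
  obtain ⟨ξ, hξ, ρ, z, h1, h2, hz, hz0, hzi, hF, hzE⟩ := h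
  let d := t₀ - s₀
  have hd : 0 ≤ d := by simp only [d]; linarith
  let j : ℝ × EuclideanSpace ℝ (Fin p) → ℝ × EuclideanSpace ℝ (Fin p) := fun w => (w.1 - d, w.2)
  have hj : Measurable j := by fun_prop
  have hzc : Continuous fun r => z (r + d) := by fun_prop
  refine ⟨ξ - d, ⟨by simp only [d]; linarith [hξ.1], by linarith [hξ.2]⟩, ρ.map j,
    fun r => z (r + d), ?_, ?_, hzc, ?_, ?_, ?_, ?_⟩
  · rw [Measure.map_map measurable_fst hj]
    have : Prod.fst ∘ j = (fun r => r - d) ∘ Prod.fst := rfl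
    rw [this, ← Measure.map_map (by fun_prop) measurable_fst, h1]
    have := ((measurePreserving_sub_right (volume : Measure ℝ) d).restrict_preimage
      (measurableSet_Icc (a := s₀) (b := ξ - d))).map_eq
    rw [← this]
    congr 2
    ext r
    simp only [Set.mem_preimage, Set.mem_Icc, d]
    constructor <;> rintro ⟨a, b⟩ <;> constructor <;> linarith
  · rw [Measure.map_apply hj (MeasurableSet.univ.prod hP).compl]
    exact h2
  · simp [d, hz0]
  · intro s hs
    have hs' : s + d ∈ Set.Icc t₀ ξ := ⟨by simp only [d]; linarith [hs.1], by linarith [hs.2]⟩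
    have hc : Continuous fun w : ℝ × EuclideanSpace ℝ (Fin p) => g (z (w.1 + d)) w.2 :=
      hg.comp (by fun_prop : Continuous fun w : ℝ × EuclideanSpace ℝ (Fin p) => (z (w.1 + d), w.2))
    rw [setIntegral_map (measurable_fst measurableSet_Iic) hc.aestronglyMeasurable hj.aemeasurable]
    change z (s + d) = _
    rw [hzi _ hs']
    congr 1
    have : j ⁻¹' (Prod.fst ⁻¹' Set.Iic s) = Prod.fst ⁻¹' Set.Iic (s + d) := by
      ext w; simp [j]
    rw [this]
    simp [j]
  · simpa using hF
  · intro s hs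
    have hs' : s + d ∈ Set.Icc t₀ ξ := ⟨by simp only [d]; linarith [hs.1], by linarith [hs.2]⟩
    exact hE.down _ _ _ (hzE _ hs') (hs0.trans hs.1) (by linarith)

theorem aux_reach_timechange {n p : ℕ} (ϑ : ℝ) (P : Set (EuclideanSpace ℝ (Fin p)))
    (hPc : IsCompact P)
    (g : EuclideanSpace ℝ (Fin n) → EuclideanSpace ℝ (Fin p) → EuclideanSpace ℝ (Fin n))
    (hg : Continuous fun w : EuclideanSpace ℝ (Fin n) × EuclideanSpace ℝ (Fin p) => g w.1 w.2)
    (F : Set (EuclideanSpace ℝ (Fin n))) (E : Set (ℝ × EuclideanSpace ℝ (Fin n)))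
    (hE : AuxGood ϑ F E) (t₀ : ℝ) (ht : t₀ ∈ Set.Icc 0 ϑ) (x₀ : EuclideanSpace ℝ (Fin n))
    (ρ : Measure (ℝ × EuclideanSpace ℝ (Fin p)))
    (h1 : ρ.map Prod.fst ≤ volume.restrict (Set.Icc t₀ ϑ)) (h2 : ρ ((Set.univ ×ˢ P)ᶜ) = 0)
    (y : ℝ → EuclideanSpace ℝ (Fin n)) (hy : Continuous y) (hy0 : y t₀ = x₀)
    (hyi : ∀ s ∈ Set.Icc t₀ ϑ, y s = x₀ + ∫ w in Prod.fst ⁻¹' Set.Iic s, g (y w.1) w.2 ∂ρ)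
    (hyF : y ϑ ∈ F) (hyE : ∀ s ∈ Set.Icc t₀ ϑ, (s, y s) ∈ E) : AuxReach ϑ P g F E t₀ x₀ := by
  have hfin : IsFiniteMeasure ρ := aux_finite _ _ ρ h1
  have hae := aux_ae P _ measurableSet_Icc ρ h1 h2
  set m : Measure ℝ := ρ.map Prod.fst with hm
  have hmfin : IsFiniteMeasure m := by rw [hm]; infer_instance
  have hmae : ∀ᵐ t ∂m, t ∈ Set.Icc t₀ ϑ :=
    (Measure.absolutelyContinuous_of_le h1).ae_le (ae_restrict_mem measurableSet_Icc)
  let τ : ℝ → ℝ := fun t => t₀ + m.real (Set.Iic t)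
  have hτdiff : ∀ a b, a ≤ b → τ b - τ a = m.real (Set.Ioc a b) := by
    intro a b hab
    have := measureReal_union (μ := m) (s₁ := Set.Iic a) (s₂ := Set.Ioc a b)
      (Set.Iic_disjoint_Ioc le_rfl) measurableSet_Ioc
    rw [Set.Iic_union_Ioc_eq_Iic hab] at this
    simp only [τ]; linarith
  have hτmono : Monotone τ := fun a b hab => by
    have := hτdiff a b hab
    have h0 : 0 ≤ m.real (Set.Ioc a b) := measureReal_nonneg
    linarith
  have hτlip : ∀ a b, a ≤ b → τ b - τ a ≤ b - a := by
    intro a b hab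
    rw [hτdiff a b hab]
    have h3 : m (Set.Ioc a b) ≤ ENNReal.ofReal (b - a) :=
      (h1 _).trans ((Measure.restrict_apply_le _ _).trans (by simp))
    exact ENNReal.toReal_le_of_le_ofReal (by linarith) h3
  have hτt0 : τ t₀ = t₀ := by
    have : m (Set.Iic t₀) = 0 := by
      refine le_antisymm ((h1 _).trans ?_) bot_le
      rw [Measure.restrict_apply measurableSet_Iic]
      refine (measure_mono (t := {t₀}) ?_).trans (by simp)
      rintro s ⟨hs, hs'⟩
      exact le_antisymm hs hs'.1
    simp [τ, Measure.real, this]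
  have hτge : ∀ t, t₀ ≤ τ t := fun t => by
    simp only [τ]; linarith [measureReal_nonneg (μ := m) (s := Set.Iic t)]
  have hτle : ∀ t, t₀ ≤ t → τ t ≤ t := fun t h => by
    have := hτlip _ _ h
    linarith
  have hτc : Continuous τ := by
    refine (LipschitzWith.of_dist_le_mul (K := 1) fun a b => ?_).continuous
    rw [NNReal.coe_one, one_mul, Real.dist_eq, Real.dist_eq]
    rcases le_total a b with h | h
    · rw [abs_sub_comm, abs_sub_comm a b, abs_of_nonneg (sub_nonneg.2 (hτmono h)),
        abs_of_nonneg (sub_nonneg.2 h)]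
      exact hτlip _ _ h
    · rw [abs_of_nonneg (sub_nonneg.2 (hτmono h)), abs_of_nonneg (sub_nonneg.2 h)]
      exact hτlip _ _ h
  set ξ := τ ϑ with hξ
  have hex : ∀ s : ℝ, ∃ t, s ∈ Set.Icc t₀ ξ → t ∈ Set.Icc t₀ ϑ ∧ τ t = s ∧
      ∀ r ∈ Set.Icc t₀ ϑ, τ r ≤ s → r ≤ t := by
    intro s
    by_cases hs : s ∈ Set.Icc t₀ ξ
    swap
    · exact ⟨0, fun h => absurd h hs⟩
    have hcp : IsCompact (Set.Icc t₀ ϑ ∩ τ ⁻¹' {s}) :=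
      isCompact_Icc.inter_right (isClosed_singleton.preimage hτc)
    have hne : (Set.Icc t₀ ϑ ∩ τ ⁻¹' {s}).Nonempty := by
      obtain ⟨t, ht', hts⟩ := intermediate_value_Icc ht.2 hτc.continuousOn
        (show s ∈ Set.Icc (τ t₀) (τ ϑ) by rw [hτt0]; exact hs)
      exact ⟨t, ht', hts⟩
    obtain ⟨t, htm, htu⟩ := hcp.exists_isGreatest hne
    refine ⟨t, fun _ => ⟨htm.1, htm.2, fun r hr hrs => ?_⟩⟩
    by_contra hlt
    push Not at hlt
    have : τ r = s := le_antisymm hrs (htm.2 ▸ hτmono hlt.le)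
    exact absurd (htu ⟨hr, this⟩) (not_le.2 hlt)
  choose σ hσ using hex
  have hgy : Continuous fun w : ℝ × EuclideanSpace ℝ (Fin p) => g (y w.1) w.2 :=
    hg.comp (by fun_prop : Continuous fun w : ℝ × EuclideanSpace ℝ (Fin p) => (y w.1, w.2))
  have hint := aux_integrable P hPc t₀ ϑ ρ hae _ hgy
  obtain ⟨K, hK⟩ := (isCompact_Icc (a := t₀) (b := ϑ)).prod hPc |>.exists_bound_of_continuousOn
    hgy.continuousOn
  have hylip : ∀ a ∈ Set.Icc t₀ ϑ, ∀ b ∈ Set.Icc t₀ ϑ, a ≤ b → ‖y b - y a‖ ≤ K * (τ b - τ a) := by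
    intro a ha b hb hab
    have hu : (Prod.fst ⁻¹' Set.Iic b : Set (ℝ × EuclideanSpace ℝ (Fin p))) =
        Prod.fst ⁻¹' Set.Iic a ∪ Prod.fst ⁻¹' Set.Ioc a b := by
      rw [← Set.preimage_union, Set.Iic_union_Ioc_eq_Iic hab]
    have e : y b - y a = ∫ w in Prod.fst ⁻¹' Set.Ioc a b, g (y w.1) w.2 ∂ρ := by
      rw [hyi b hb, hyi a ha, hu, setIntegral_union
        ((Set.Iic_disjoint_Ioc le_rfl).preimage _) (measurable_fst measurableSet_Ioc)
        hint.integrableOn hint.integrableOn]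
      abel
    rw [e, hτdiff a b hab]
    have : m.real (Set.Ioc a b) = ρ.real (Prod.fst ⁻¹' Set.Ioc a b) := by
      simp only [Measure.real, hm]
      rw [Measure.map_apply measurable_fst measurableSet_Ioc]
    rw [this]
    refine norm_setIntegral_le_of_norm_le_const_ae (measure_lt_top _ _) ?_
    refine ae_restrict_of_ae ?_
    filter_upwards [hae] with w hw using hK w hw
  have hyeq : ∀ a ∈ Set.Icc t₀ ϑ, ∀ b ∈ Set.Icc t₀ ϑ, τ a = τ b → y a = y b := by
    intro a ha b hb hab
    rcases le_total a b with h | h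
    · have := hylip a ha b hb h
      rw [hab, sub_self, mul_zero] at this
      exact (sub_eq_zero.1 (norm_le_zero_iff.1 this)).symm
    · have := hylip b hb a ha h
      rw [hab, sub_self, mul_zero] at this
      exact (sub_eq_zero.1 (norm_le_zero_iff.1 this))
  have htξ : t₀ ≤ ξ := hτge ϑ
  have hσmono : ∀ a ∈ Set.Icc t₀ ξ, ∀ b ∈ Set.Icc t₀ ξ, a ≤ b → σ a ≤ σ b := by
    intro a ha b hb hab
    exact (hσ b hb).2.2 _ (hσ a ha).1 ((hσ a ha).2.1.le.trans hab)
  have hZc : ContinuousOn (fun s => y (σ s)) (Set.Icc t₀ ξ) := by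
    have key : ∀ a ∈ Set.Icc t₀ ξ, ∀ b ∈ Set.Icc t₀ ξ, a ≤ b →
        dist (y (σ a)) (y (σ b)) ≤ Real.toNNReal K * dist a b := by
      intro a ha b hb hab
      have := hylip _ (hσ a ha).1 _ (hσ b hb).1 (hσmono a ha b hb hab)
      rw [(hσ a ha).2.1, (hσ b hb).2.1] at this
      rw [dist_comm, dist_eq_norm, dist_comm, Real.dist_eq, abs_of_nonneg (sub_nonneg.2 hab)]
      refine this.trans ?_
      exact mul_le_mul_of_nonneg_right (Real.le_coe_toNNReal K) (sub_nonneg.2 hab)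
    refine (LipschitzOnWith.of_dist_le_mul (K := Real.toNNReal K) fun a ha b hb => ?_).continuousOn
    rcases le_total a b with h | h
    · exact key a ha b hb h
    · rw [dist_comm, dist_comm a b]; exact key b hb a ha h
  let z : ℝ → EuclideanSpace ℝ (Fin n) :=
    Set.IccExtend htξ ((Set.Icc t₀ ξ).domRestrict fun s => y (σ s))
  have hz : ∀ s ∈ Set.Icc t₀ ξ, z s = y (σ s) := fun s hs => by
    simp only [z]
    rw [Set.IccExtend_of_mem _ _ hs]; rfl
  have hzc : Continuous z := (continuousOn_iff_continuous_domRestrict.1 hZc).Icc_extend'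
  have hτmem : ∀ t ∈ Set.Icc t₀ ϑ, τ t ∈ Set.Icc t₀ ξ := fun t ht => ⟨hτge t, hτmono ht.2⟩
  have hzτ : ∀ t ∈ Set.Icc t₀ ϑ, z (τ t) = y t := fun t ht => by
    have := hσ _ (hτmem t ht)
    rw [hz _ (hτmem t ht)]
    exact hyeq _ this.1 _ ht this.2.1
  have hτσ : ∀ s ∈ Set.Icc t₀ ξ, ∀ t ∈ Set.Icc t₀ ϑ, (τ t ≤ s ↔ t ≤ σ s) := fun s hs t ht =>
    ⟨(hσ s hs).2.2 t ht, fun h => (hτmono h).trans (hσ s hs).2.1.le⟩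
  let j : ℝ × EuclideanSpace ℝ (Fin p) → ℝ × EuclideanSpace ℝ (Fin p) := fun w => (τ w.1, w.2)
  have hjc : Continuous j := by fun_prop
  have hj : Measurable j := hjc.measurable
  refine ⟨ξ, ⟨htξ, hτle ϑ ht.2⟩, ρ.map j, z, ?_, ?_, hzc, ?_, ?_, ?_, ?_⟩
  · rw [Measure.map_map measurable_fst hj]
    have : Prod.fst ∘ j = τ ∘ Prod.fst := rfl
    rw [this, ← Measure.map_map hτc.measurable measurable_fst, ← hm]
    have key : ∀ s ∈ Set.Icc t₀ ξ, m (τ ⁻¹' Set.Iic s) = ENNReal.ofReal (s - t₀) := by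
      intro s hs
      have : m (τ ⁻¹' Set.Iic s) = m (Set.Iic (σ s)) := by
        refine measure_congr ?_
        filter_upwards [hmae] with t ht'
        exact propext (hτσ s hs t ht')
      rw [this, ← ofReal_measureReal]
      congr 1
      have := (hσ s hs).2.1
      simp only [τ] at this
      linarith
    refine Measure.ext_of_Iic _ _ fun s => ?_
    rw [Measure.map_apply hτc.measurable measurableSet_Iic, Measure.restrict_apply measurableSet_Iic]
    rcases lt_or_ge s t₀ with h | h
    · have e1 : τ ⁻¹' Set.Iic s = ∅ := by
        ext t; simpa using h.trans_le (hτge t)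
      have e2 : Set.Iic s ∩ Set.Icc t₀ ξ = ∅ := by
        ext t; simp only [Set.mem_inter_iff, Set.mem_Iic, Set.mem_Icc, Set.mem_empty_iff_false]
        grind
      rw [e1, e2]; simp
    rcases le_total s ξ with h' | h'
    · have e2 : Set.Iic s ∩ Set.Icc t₀ ξ = Set.Icc t₀ s := by
        ext t; simp only [Set.mem_inter_iff, Set.mem_Iic, Set.mem_Icc]
        grind
      rw [e2, key s ⟨h, h'⟩, Real.volume_Icc]
    · have e1 : m (τ ⁻¹' Set.Iic s) = m (τ ⁻¹' Set.Iic ξ) := by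
        refine measure_congr ?_
        filter_upwards [hmae] with t ht'
        have := (hτmem t ht').2
        exact propext ⟨fun _ => this, fun _ => this.trans h'⟩
      have e2 : Set.Iic s ∩ Set.Icc t₀ ξ = Set.Icc t₀ ξ := by
        ext t; simp only [Set.mem_inter_iff, Set.mem_Iic, Set.mem_Icc]
        grind
      rw [e1, e2, key ξ ⟨htξ, le_rfl⟩, Real.volume_Icc]
  · rw [Measure.map_apply hj (MeasurableSet.univ.prod hPc.measurableSet).compl]
    exact h2
  · have := hzτ t₀ ⟨le_rfl, ht.2⟩
    rw [hτt0] at this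
    rw [this, hy0]
  · intro s hs
    have hgz : Continuous fun w : ℝ × EuclideanSpace ℝ (Fin p) => g (z w.1) w.2 :=
      hg.comp (by fun_prop : Continuous fun w : ℝ × EuclideanSpace ℝ (Fin p) => (z w.1, w.2))
    rw [setIntegral_map (measurable_fst measurableSet_Iic) hgz.aestronglyMeasurable hj.aemeasurable,
      hz s hs, hyi _ (hσ s hs).1]
    congr 1
    have e1 : (fun w : ℝ × EuclideanSpace ℝ (Fin p) => g (z (j w).1) (j w).2) =ᵐ[ρ]
        fun w => g (y w.1) w.2 := by
      filter_upwards [hae] with w hw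
      simp only [j]
      rw [hzτ _ hw.1]
    rw [integral_congr_ae (ae_restrict_of_ae e1)]
    refine setIntegral_congr_set ?_
    filter_upwards [hae] with w hw
    exact propext (hτσ s hs _ hw.1).symm
  · rw [hzτ ϑ ⟨ht.2, le_rfl⟩]; exact hyF
  · intro s hs
    rw [hz s hs]
    have := hσ s hs
    refine hE.down _ _ _ (hyE _ this.1) (ht.1.trans hs.1) ?_
    have h3 := hτle _ this.1.1
    rw [this.2.1] at h3
    exact h3

theorem aux_cyl_to_reach {n p : ℕ} (ϑ : ℝ) (P : Set (EuclideanSpace ℝ (Fin p)))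
    (hP : MeasurableSet P)
    (g : EuclideanSpace ℝ (Fin n) → EuclideanSpace ℝ (Fin p) → EuclideanSpace ℝ (Fin n))
    (F : Set (EuclideanSpace ℝ (Fin n))) (E : Set (ℝ × EuclideanSpace ℝ (Fin n)))
    (t₀ : ℝ) (ht : t₀ ∈ Set.Icc 0 ϑ) (x₀ : EuclideanSpace ℝ (Fin n))
    (μ : Measure (ℝ × EuclideanSpace ℝ (Fin p))) (hμ : IsSlideControl ϑ P μ)
    (ξ : ℝ) (hξ : ξ ∈ Set.Icc t₀ ϑ) (y : ℝ → EuclideanSpace ℝ (Fin n))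
    (hy : IsMotion ϑ P g μ t₀ x₀ y) (hF : y ξ ∈ F) (hyE : ∀ t ∈ Set.Icc t₀ ξ, (t, y t) ∈ E) :
    AuxReach ϑ P g F E t₀ x₀ := by
  obtain ⟨hyc, hy0, hyf, -⟩ := hy
  obtain ⟨hm1, hm2⟩ := hμ
  have hsub : Set.Icc t₀ ξ ⊆ Set.Icc 0 ϑ := Set.Icc_subset_Icc ht.1 hξ.2
  let z : ℝ → EuclideanSpace ℝ (Fin n) := Set.IccExtend hξ.1 ((Set.Icc t₀ ξ).domRestrict y)
  have hz : ∀ s ∈ Set.Icc t₀ ξ, z s = y s := fun s hs => by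
    simp only [z]
    rw [Set.IccExtend_of_mem _ _ hs]; rfl
  have hzc : Continuous z :=
    (continuousOn_iff_continuous_domRestrict.1 (hyc.mono hsub)).Icc_extend'
  have haeP : ∀ᵐ w ∂μ, w ∈ Set.Icc 0 ϑ ×ˢ P := hm2
  refine ⟨ξ, hξ, μ.restrict (Prod.fst ⁻¹' Set.Icc t₀ ξ), z, ?_, ?_, hzc, ?_, ?_, ?_, ?_⟩
  · rw [← Measure.restrict_map measurable_fst measurableSet_Icc, hm1,
      Measure.restrict_restrict measurableSet_Icc, Set.inter_eq_left.2 hsub]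
  · have : ∀ᵐ w ∂μ, w ∈ (Set.univ ×ˢ P : Set (ℝ × EuclideanSpace ℝ (Fin p))) := by
      filter_upwards [haeP] with w hw using ⟨trivial, hw.2⟩
    exact ae_restrict_of_ae this
  · rw [hz _ ⟨le_rfl, hξ.1⟩, hy0]
  · intro s hs
    rw [Measure.restrict_restrict (measurable_fst measurableSet_Iic), hz s hs,
      hyf s (hsub hs) hs.1]
    congr 1
    have e : ∫ w in Set.Icc t₀ s ×ˢ P, g (y w.1) w.2 ∂μ =
        ∫ w in Set.Icc t₀ s ×ˢ P, g (z w.1) w.2 ∂μ := by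
      refine setIntegral_congr_fun (measurableSet_Icc.prod hP) fun w hw => ?_
      simp only [hz w.1 ⟨hw.1.1, hw.1.2.trans hs.2⟩]
    rw [e]
    refine setIntegral_congr_set ?_
    filter_upwards [haeP] with w hw
    apply propext
    exact ⟨fun h => ⟨h.1.2, h.1.1, h.1.2.trans hs.2⟩, fun h => ⟨⟨h.2.1, h.1⟩, hw.2⟩⟩
  · rw [hz _ ⟨hξ.1, le_rfl⟩]; exact hF
  · intro s hs
    rw [hz s hs]; exact hyE s hs

theorem aux_switched_to_reach {n p : ℕ} (ϑ : ℝ) (P : Set (EuclideanSpace ℝ (Fin p)))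
    (hPc : IsCompact P)
    (g : EuclideanSpace ℝ (Fin n) → EuclideanSpace ℝ (Fin p) → EuclideanSpace ℝ (Fin n))
    (hg : Continuous fun w : EuclideanSpace ℝ (Fin n) × EuclideanSpace ℝ (Fin p) => g w.1 w.2)
    (F : Set (EuclideanSpace ℝ (Fin n))) (E : Set (ℝ × EuclideanSpace ℝ (Fin n)))
    (hE : AuxGood ϑ F E)
    (t₀ : ℝ) (ht : t₀ ∈ Set.Icc 0 ϑ) (x₀ : EuclideanSpace ℝ (Fin n))
    (μ : Measure (ℝ × (ℝ × EuclideanSpace ℝ (Fin p))))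
    (hμ : IsSlideControl ϑ (({0, 1} : Set ℝ) ×ˢ P) μ)
    (y : ℝ → EuclideanSpace ℝ (Fin n))
    (hy : IsMotion ϑ (({0, 1} : Set ℝ) ×ˢ P) (fun x w => w.1 • g x w.2) μ t₀ x₀ y)
    (hF : y ϑ ∈ F) (hyE : ∀ t ∈ Set.Icc t₀ ϑ, (t, y t) ∈ E) :
    AuxReach ϑ P g F E t₀ x₀ := by
  obtain ⟨hyc, hy0, hyf, -⟩ := hy
  obtain ⟨hm1, hm2⟩ := hμ
  have hP := hPc.measurableSet
  have hsub : Set.Icc t₀ ϑ ⊆ Set.Icc 0 ϑ := Set.Icc_subset_Icc ht.1 le_rfl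
  let z : ℝ → EuclideanSpace ℝ (Fin n) := Set.IccExtend ht.2 ((Set.Icc t₀ ϑ).domRestrict y)
  have hz : ∀ s ∈ Set.Icc t₀ ϑ, z s = y s := fun s hs => by
    simp only [z]
    rw [Set.IccExtend_of_mem _ _ hs]; rfl
  have hzc : Continuous z :=
    (continuousOn_iff_continuous_domRestrict.1 (hyc.mono hsub)).Icc_extend'
  have haeP : ∀ᵐ w ∂μ, w ∈ Set.Icc 0 ϑ ×ˢ (({0, 1} : Set ℝ) ×ˢ P) := hm2
  have h01 : MeasurableSet (({0, 1} : Set ℝ) ×ˢ P) :=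
    ((Set.finite_singleton (1 : ℝ)).insert 0).measurableSet.prod hP
  let A : Set (ℝ × (ℝ × EuclideanSpace ℝ (Fin p))) :=
    Set.Icc t₀ ϑ ×ˢ (({1} : Set ℝ) ×ˢ Set.univ)
  have hA : MeasurableSet A :=
    measurableSet_Icc.prod ((measurableSet_singleton 1).prod MeasurableSet.univ)
  let j : ℝ × (ℝ × EuclideanSpace ℝ (Fin p)) → ℝ × EuclideanSpace ℝ (Fin p) :=
    fun w => (w.1, w.2.2)
  have hj : Measurable j := by fun_prop
  refine aux_reach_timechange ϑ P hPc g hg F E hE t₀ ht x₀ ((μ.restrict A).map j) ?_ ?_ z hzc ?_ ?_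
    ?_ ?_
  · rw [Measure.map_map measurable_fst hj]
    change (μ.restrict A).map Prod.fst ≤ _
    have e : volume.restrict (Set.Icc t₀ ϑ) =
        (μ.restrict (Prod.fst ⁻¹' Set.Icc t₀ ϑ)).map Prod.fst := by
      rw [← Measure.restrict_map measurable_fst measurableSet_Icc, hm1,
        Measure.restrict_restrict measurableSet_Icc, Set.inter_eq_left.2 hsub]
    rw [e]
    refine Measure.map_mono ?_ measurable_fst
    exact Measure.restrict_mono (fun w hw => hw.1) le_rfl
  · rw [Measure.map_apply hj (MeasurableSet.univ.prod hP).compl]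
    have : ∀ᵐ w ∂μ, w ∈ j ⁻¹' (Set.univ ×ˢ P : Set (ℝ × EuclideanSpace ℝ (Fin p))) := by
      filter_upwards [haeP] with w hw using ⟨trivial, hw.2.2⟩
    exact ae_restrict_of_ae this
  · rw [hz _ ⟨le_rfl, ht.2⟩, hy0]
  · intro s hs
    have hgz : Continuous fun w : ℝ × EuclideanSpace ℝ (Fin p) => g (z w.1) w.2 :=
      hg.comp (by fun_prop : Continuous fun w : ℝ × EuclideanSpace ℝ (Fin p) => (z w.1, w.2))
    rw [setIntegral_map (measurable_fst measurableSet_Iic) hgz.aestronglyMeasurable hj.aemeasurable,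
      hz s hs, hyf s (hsub hs) hs.1,
      Measure.restrict_restrict (hj (measurable_fst measurableSet_Iic))]
    congr 1
    have e : ∫ w in Set.Icc t₀ s ×ˢ (({0, 1} : Set ℝ) ×ˢ P), w.2.1 • g (y w.1) w.2.2 ∂μ =
        ∫ w in Set.Icc t₀ s ×ˢ (({1} : Set ℝ) ×ˢ P), w.2.1 • g (y w.1) w.2.2 ∂μ := by
      refine setIntegral_eq_of_subset_of_forall_sdiff_eq_zero (measurableSet_Icc.prod h01) ?_ ?_
      · rintro w ⟨h1, h2, h3⟩
        exact ⟨h1, Or.inr h2, h3⟩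
      · rintro w ⟨⟨h1, h2, h3⟩, h4⟩
        rcases h2 with h2 | h2
        · rw [h2, zero_smul]
        · exact absurd ⟨h1, h2, h3⟩ h4
    have e2 : ∫ w in Set.Icc t₀ s ×ˢ (({1} : Set ℝ) ×ˢ P), w.2.1 • g (y w.1) w.2.2 ∂μ =
        ∫ w in Set.Icc t₀ s ×ˢ (({1} : Set ℝ) ×ˢ P), g (z (j w).1) (j w).2 ∂μ := by
      refine setIntegral_congr_fun (measurableSet_Icc.prod ((measurableSet_singleton 1).prod hP))
        fun w hw => ?_
      have h3 : w.2.1 = 1 := hw.2.1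
      simp only [j, hz w.1 ⟨hw.1.1, hw.1.2.trans hs.2⟩, h3, one_smul]
    rw [e, e2]
    refine setIntegral_congr_set ?_
    filter_upwards [haeP] with w hw
    apply propext
    exact ⟨fun h => ⟨h.1.2, ⟨h.1.1, h.1.2.trans hs.2⟩, h.2.1, trivial⟩,
      fun h => ⟨⟨h.2.1.1, h.1⟩, h.2.2.1, hw.2.2⟩⟩
  · rw [hz _ ⟨ht.2, le_rfl⟩]; exact hF
  · intro s hs
    rw [hz s hs]; exact hyE s hs

theorem aux_reach_to_switched {n p : ℕ} (ϑ : ℝ) (P : Set (EuclideanSpace ℝ (Fin p)))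
    (hPne : P.Nonempty) (hPc : IsCompact P)
    (g : EuclideanSpace ℝ (Fin n) → EuclideanSpace ℝ (Fin p) → EuclideanSpace ℝ (Fin n))
    (hg : Continuous fun w : EuclideanSpace ℝ (Fin n) × EuclideanSpace ℝ (Fin p) => g w.1 w.2)
    (F : Set (EuclideanSpace ℝ (Fin n))) (E : Set (ℝ × EuclideanSpace ℝ (Fin n)))
    (hE : AuxGood ϑ F E)
    (t₀ : ℝ) (ht : t₀ ∈ Set.Icc 0 ϑ) (x₀ : EuclideanSpace ℝ (Fin n))
    (h : AuxReach ϑ P g F E t₀ x₀) :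
    ∃ μ : Measure (ℝ × (ℝ × EuclideanSpace ℝ (Fin p))),
      IsSlideControl ϑ (({0, 1} : Set ℝ) ×ˢ P) μ ∧ ∃ y : ℝ → EuclideanSpace ℝ (Fin n),
      IsMotion ϑ (({0, 1} : Set ℝ) ×ˢ P) (fun x w => w.1 • g x w.2) μ t₀ x₀ y ∧
      y ϑ ∈ F ∧ ∀ t ∈ Set.Icc t₀ ϑ, (t, y t) ∈ E := by
  obtain ⟨ξ, hξ, ρ, z, h1, h2, hz, hz0, hzi, hF, hzE⟩ := h
  obtain ⟨u₀, hu₀⟩ := hPne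
  have hP := hPc.measurableSet
  have hfin : IsFiniteMeasure ρ := aux_finite _ _ ρ h1.le
  have hae := aux_ae P _ measurableSet_Icc ρ h1.le h2
  have h01 : MeasurableSet (({0, 1} : Set ℝ) ×ˢ P) :=
    ((Set.finite_singleton (1 : ℝ)).insert 0).measurableSet.prod hP
  let j : ℝ × EuclideanSpace ℝ (Fin p) → ℝ × (ℝ × EuclideanSpace ℝ (Fin p)) :=
    fun w => (w.1, ((1 : ℝ), w.2))
  have hj : Measurable j := by fun_prop
  have hgz : Continuous fun w : ℝ × EuclideanSpace ℝ (Fin p) => g (z w.1) w.2 :=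
    hg.comp (by fun_prop : Continuous fun w : ℝ × EuclideanSpace ℝ (Fin p) => (z w.1, w.2))
  have hgz' : Continuous fun w : ℝ × (ℝ × EuclideanSpace ℝ (Fin p)) =>
      w.2.1 • g (z w.1) w.2.2 :=
    (by fun_prop : Continuous fun w : ℝ × (ℝ × EuclideanSpace ℝ (Fin p)) => w.2.1).smul
      (hgz.comp (by fun_prop :
        Continuous fun w : ℝ × (ℝ × EuclideanSpace ℝ (Fin p)) => (w.1, w.2.2)))
  have hint := aux_integrable P hPc t₀ ξ ρ hae _ hgz
  obtain ⟨μ, y, hμ, hy, hyz, hyw⟩ := aux_ext ϑ (({0, 1} : Set ℝ) ×ˢ P) h01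
    (fun x w => w.1 • g x w.2) ((0 : ℝ), u₀) ⟨Or.inl rfl, hu₀⟩ (by simpa using continuous_const)
    t₀ ξ ht.1 hξ.1 hξ.2
    (ρ.map j) (by rw [Measure.map_map measurable_fst hj]; exact h1)
    (by
      rw [Measure.map_apply hj (MeasurableSet.univ.prod h01).compl]
      have : ∀ᵐ w ∂ρ, w ∈ j ⁻¹' (Set.univ ×ˢ (({0, 1} : Set ℝ) ×ˢ P)) := by
        filter_upwards [hae] with w hw
        exact ⟨trivial, Or.inr rfl, hw.2⟩
      exact this)
    x₀ z (fun _ => x₀) (fun _ => z ξ) hz continuous_const continuous_const hz0 rfl rfl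
    (by
      intro s hs
      rw [setIntegral_map (measurable_fst measurableSet_Iic) hgz'.aestronglyMeasurable
        hj.aemeasurable, hzi s hs]
      simp only [j, one_smul]
      rfl)
    (by
      rw [integrable_map_measure hgz'.aestronglyMeasurable hj.aemeasurable]
      simpa [j, Function.comp_def] using hint)
    (by simp) (by simp)
  refine ⟨μ, hμ, y, hy, ?_, fun t ht' => ?_⟩
  · rw [hyw ϑ ⟨hξ.2, le_rfl⟩]; exact hF
  · rcases le_total t ξ with h' | h'
    · rw [hyz t ⟨ht'.1, h'⟩]; exact hzE t ⟨ht'.1, h'⟩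
    · rw [hyw t ⟨h', ht'.2⟩]
      exact hE.tgt t ⟨ht.1.trans ht'.1, ht'.2⟩ _ hF

theorem aux_reach_to_cyl {n p : ℕ} (ϑ : ℝ) (P : Set (EuclideanSpace ℝ (Fin p)))
    (hPne : P.Nonempty) (hPc : IsCompact P)
    (g : EuclideanSpace ℝ (Fin n) → EuclideanSpace ℝ (Fin p) → EuclideanSpace ℝ (Fin n))
    (hg : Continuous fun w : EuclideanSpace ℝ (Fin n) × EuclideanSpace ℝ (Fin p) => g w.1 w.2)
    (hLip : ∀ u ∈ P, LocallyLipschitz fun x => g x u)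
    (c : ℝ) (hc : 0 < c) (hgr : ∀ x, ∀ u ∈ P, ‖g x u‖ ≤ c * (1 + ‖x‖))
    (F : Set (EuclideanSpace ℝ (Fin n))) (E : Set (ℝ × EuclideanSpace ℝ (Fin n)))
    (t₀ : ℝ) (ht : t₀ ∈ Set.Icc 0 ϑ) (x₀ : EuclideanSpace ℝ (Fin n))
    (h : AuxReach ϑ P g F E t₀ x₀) :
    ∃ μ : Measure (ℝ × EuclideanSpace ℝ (Fin p)),
      IsSlideControl ϑ P μ ∧ ∃ ξ ∈ Set.Icc t₀ ϑ, ∃ y : ℝ → EuclideanSpace ℝ (Fin n),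
      IsMotion ϑ P g μ t₀ x₀ y ∧ y ξ ∈ F ∧
      ∀ t ∈ Set.Icc t₀ ξ, (t, y t) ∈ E := by
  obtain ⟨ξ, hξ, ρ, z, h1, h2, hz, hz0, hzi, hF, hzE⟩ := h
  obtain ⟨u₀, hu₀⟩ := hPne
  have hP := hPc.measurableSet
  have hfin : IsFiniteMeasure ρ := aux_finite _ _ ρ h1.le
  have hae := aux_ae P _ measurableSet_Icc ρ h1.le h2
  have hgz : Continuous fun w : ℝ × EuclideanSpace ℝ (Fin p) => g (z w.1) w.2 :=
    hg.comp (by fun_prop : Continuous fun w : ℝ × EuclideanSpace ℝ (Fin p) => (z w.1, w.2))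
  have hint := aux_integrable P hPc t₀ ξ ρ hae _ hgz
  have hneg : LocallyLipschitz fun x => -g x u₀ :=
    (LipschitzWith.id.neg.locallyLipschitz).comp (hLip u₀ hu₀)
  obtain ⟨a, hac, ha0, ha⟩ := aux_ode_fwd (fun x => -g x u₀) hneg c hc
    (fun x => by rw [norm_neg]; exact hgr x u₀ hu₀) x₀ t₀ ht.1
  obtain ⟨b, hbc, hb0, hb⟩ := aux_ode_fwd (fun x => g x u₀) (hLip u₀ hu₀) c hc
    (fun x => hgr x u₀ hu₀) (z ξ) (ϑ - ξ) (by linarith [hξ.2])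
  obtain ⟨μ, y, hμ, hy, hyz, hyw⟩ := aux_ext ϑ P hP g u₀ hu₀ (hLip u₀ hu₀).continuous
    t₀ ξ ht.1 hξ.1 hξ.2 ρ h1 h2 x₀ z (fun s => a (t₀ - s)) (fun s => b (s - ξ)) hz
    (by fun_prop) (by fun_prop) hz0 (by simp [ha0]) (by simp [hb0]) hzi hint
    (by
      intro s hs
      rw [ha (t₀ - s) ⟨by linarith [hs.2], by linarith [hs.1]⟩, intervalIntegral.integral_neg,
        ← sub_eq_add_neg, intervalIntegral.integral_comp_sub_left (fun r => g (a r) u₀) t₀, sub_self])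
    (by
      intro s hs
      rw [hb (s - ξ) ⟨by linarith [hs.1], by linarith [hs.2]⟩,
        intervalIntegral.integral_comp_sub_right (fun r => g (b r) u₀) ξ, sub_self])
  refine ⟨μ, hμ, ξ, hξ, y, hy, ?_, fun t ht' => ?_⟩
  · rw [hyz ξ ⟨hξ.1, le_rfl⟩]; exact hF
  · rw [hyz t ht']; exact hzE t ht'

/-- cylindrical-target special case of the paper's Theorem.  For the target
set `M = [0,ϑ] × F`, the Programmed Iteration sequences of the original game and of the
switched game `ẋ = ν·f(x,u,v)` with target `{ϑ} × F` coincide: `W_k = W*_k` for all `k`. -/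
theorem programmed_iterations_coincide_cylindrical
    {n p q : ℕ} (ϑ : ℝ) (hϑ : 0 < ϑ)
    (P : Set (EuclideanSpace ℝ (Fin p))) (Q : Set (EuclideanSpace ℝ (Fin q)))
    (hPne : P.Nonempty) (hPc : IsCompact P)
    (hQne : Q.Nonempty) (hQc : IsCompact Q)
    (f : EuclideanSpace ℝ (Fin n) → EuclideanSpace ℝ (Fin p) → EuclideanSpace ℝ (Fin q) →
      EuclideanSpace ℝ (Fin n))
    (hf : Continuous fun z : EuclideanSpace ℝ (Fin n) × EuclideanSpace ℝ (Fin p) ×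
      EuclideanSpace ℝ (Fin q) => f z.1 z.2.1 z.2.2)
    (hfLip : ∀ x₀ : EuclideanSpace ℝ (Fin n), ∃ ε > (0 : ℝ), ∃ L : NNReal,
      ∀ u ∈ P, ∀ v ∈ Q, LipschitzOnWith L (fun x => f x u v) (Metric.ball x₀ ε))
    (hfGrow : ∃ c > (0 : ℝ), ∀ x, ∀ u ∈ P, ∀ v ∈ Q, ‖f x u v‖ ≤ c * (1 + ‖x‖))
    (F : Set (EuclideanSpace ℝ (Fin n))) (hFcl : IsClosed F) (hFne : F.Nonempty) :
    ∀ k : ℕ,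
      (fun E => progAbsorbCyl ϑ P Q f F E)^[k]
          (Set.Icc 0 ϑ ×ˢ (Set.univ : Set (EuclideanSpace ℝ (Fin n)))) =
        (fun E => progAbsorbSwitched ϑ P Q f F E)^[k]
          (Set.Icc 0 ϑ ×ˢ (Set.univ : Set (EuclideanSpace ℝ (Fin n)))) := by
  obtain ⟨c, hc, hgr⟩ := hfGrow
  have hgc : ∀ v, Continuous fun w : EuclideanSpace ℝ (Fin n) × EuclideanSpace ℝ (Fin p) =>
      f w.1 w.2 v := fun v => hf.comp (by fun_prop :
    Continuous fun w : EuclideanSpace ℝ (Fin n) × EuclideanSpace ℝ (Fin p) => (w.1, w.2, v))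
  have hL : ∀ v ∈ Q, ∀ u ∈ P, LocallyLipschitz fun x => f x u v := by
    intro v hv u hu x
    obtain ⟨ε, hε, L, hLip⟩ := hfLip x
    exact ⟨L, Metric.ball x ε, Metric.ball_mem_nhds x hε, hLip u hu v hv⟩
  have hA : ∀ E, AuxGood ϑ F E → progAbsorbCyl ϑ P Q f F E =
      {pt ∈ E | ∀ v ∈ Q, AuxReach ϑ P (fun x u => f x u v) F E pt.1 pt.2} := by
    intro E hE
    ext pt
    constructor
    · rintro ⟨hpt, h⟩
      refine ⟨hpt, fun v hv => ?_⟩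
      obtain ⟨μ, hμ, ξ, hξ, y, hy, hyF, hyE⟩ := h v hv
      exact aux_cyl_to_reach ϑ P hPc.measurableSet _ F E pt.1 (hE.sub pt hpt) pt.2 μ hμ ξ hξ y hy
        hyF hyE
    · rintro ⟨hpt, h⟩
      refine ⟨hpt, fun v hv => ?_⟩
      exact aux_reach_to_cyl ϑ P hPne hPc _ (hgc v) (hL v hv) c hc
        (fun x u hu => hgr x u hu v hv) F E pt.1 (hE.sub pt hpt) pt.2 (h v hv)
  have hB : ∀ E, AuxGood ϑ F E → progAbsorbSwitched ϑ P Q f F E =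
      {pt ∈ E | ∀ v ∈ Q, AuxReach ϑ P (fun x u => f x u v) F E pt.1 pt.2} := by
    intro E hE
    ext pt
    constructor
    · rintro ⟨hpt, h⟩
      refine ⟨hpt, fun v hv => ?_⟩
      obtain ⟨μ, hμ, y, hy, hyF, hyE⟩ := h v hv
      exact aux_switched_to_reach ϑ P hPc _ (hgc v) F E hE pt.1 (hE.sub pt hpt) pt.2 μ hμ y hy
        hyF hyE
    · rintro ⟨hpt, h⟩
      refine ⟨hpt, fun v hv => ?_⟩
      exact aux_reach_to_switched ϑ P hPne hPc _ (hgc v) F E hE pt.1 (hE.sub pt hpt) pt.2 (h v hv)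
  have hG : ∀ E, AuxGood ϑ F E → AuxGood ϑ F (progAbsorbCyl ϑ P Q f F E) := by
    intro E hE
    rw [hA E hE]
    refine ⟨fun pt hpt => hE.sub pt hpt.1, fun t ht x hx => ⟨hE.tgt t ht x hx, fun v _ => ?_⟩,
      fun t x s h hs hst => ⟨hE.down t x s h.1 hs hst, fun v hv => ?_⟩⟩
    · exact aux_reach_tgt ϑ P _ F E hE t ht x hx
    · exact aux_reach_down ϑ P _ (hgc v) hPc.measurableSet F E hE t s x hs hst (h.2 v hv)
  have key : ∀ k : ℕ,
      AuxGood ϑ F ((fun E => progAbsorbCyl ϑ P Q f F E)^[k]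
          (Set.Icc 0 ϑ ×ˢ (Set.univ : Set (EuclideanSpace ℝ (Fin n))))) ∧
      (fun E => progAbsorbCyl ϑ P Q f F E)^[k]
          (Set.Icc 0 ϑ ×ˢ (Set.univ : Set (EuclideanSpace ℝ (Fin n)))) =
        (fun E => progAbsorbSwitched ϑ P Q f F E)^[k]
          (Set.Icc 0 ϑ ×ˢ (Set.univ : Set (EuclideanSpace ℝ (Fin n)))) := by
    intro k
    induction k with
    | zero =>
      refine ⟨⟨fun pt hpt => hpt.1, fun t ht x _ => ⟨ht, trivial⟩, fun t x s h hs hst =>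
        ⟨⟨hs, hst.trans h.1.2⟩, trivial⟩⟩, rfl⟩
    | succ k ih =>
      obtain ⟨ih1, ih2⟩ := ih
      rw [Function.iterate_succ_apply', Function.iterate_succ_apply', ← ih2]
      exact ⟨hG _ ih1, (hA _ ih1).trans (hB _ ih1).symm⟩
  exact fun k => (key k).2
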